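/- arXiv:2301.11679 — 5 statements merged into one kernel-verified Lean document; each statement's English description precedes it below -/
import Mathlib

section
/- Let μ be a finite Borel measure on ℝ and let t > 0. Assume that the series ∑_{n=0}^∞ (tⁿ/n!)·(∫_ℝ x^{2n} dμ(x))^{1/2} converges (in particular all even moments of μ are finite). Then for every s ∈ [0,t] the function x ↦ e^{s|x|} is μ-integrable, i.e. ∫_ℝ e^{s|x|} dμ(x) < ∞. -/
open MeasureTheory

/-- Cauchy-Schwarz bound on absolute moments. -/
theorem moment_bound (μ : Measure ℝ) [IsFiniteMeasure μ] (n : ℕ)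
    (h : Integrable (fun x : ℝ => x ^ (2 * n)) μ) :
    Integrable (fun x : ℝ => |x| ^ n) μ ∧
      ∫ x, |x| ^ n ∂μ ≤ Real.sqrt (∫ x, x ^ (2 * n) ∂μ) * Real.sqrt (μ.real Set.univ) := by
  have hm : AEStronglyMeasurable (fun x : ℝ => |x| ^ n) μ :=
    (by fun_prop : Continuous (fun x : ℝ => |x| ^ n)).aestronglyMeasurable
  have e : ∀ x : ℝ, (|x| ^ n) ^ 2 = x ^ (2 * n) := fun x => by
    rw [← pow_mul, mul_comm, pow_mul, sq_abs, ← pow_mul]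
  have hL : MemLp (fun x : ℝ => |x| ^ n) 2 μ := by
    rw [memLp_two_iff_integrable_sq hm]
    simpa only [e] using h
  refine ⟨hL.integrable (by norm_num), ?_⟩
  have := integral_mul_le_Lp_mul_Lq_of_nonneg (μ := μ) (p := 2) (q := 2)
    (f := fun x : ℝ => |x| ^ n) (g := fun _ => (1 : ℝ)) Real.HolderConjugate.two_two
    (Filter.Eventually.of_forall fun x => by positivity)
    (Filter.Eventually.of_forall fun x => by simp) (by simpa using hL) (memLp_const 1)
  simpa [e, Real.sqrt_eq_rpow] using this

/-- Spectral-measure content of the exponential decay lemma: if the square roots of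
the even moments of a finite Borel measure `μ` on `ℝ` satisfy the analytic-vector
summability condition for some `t > 0`, then `x ↦ exp (s * |x|)` is `μ`-integrable
for every `s ∈ [0, t]`. -/
theorem stmt_0 (μ : Measure ℝ) [IsFiniteMeasure μ] (t : ℝ) (ht : 0 < t)
    (hmom : ∀ n : ℕ, Integrable (fun x : ℝ => x ^ (2 * n)) μ)
    (hsum : Summable (fun n : ℕ =>
      t ^ n / n.factorial * Real.sqrt (∫ x, x ^ (2 * n) ∂μ))) :
    ∀ s ∈ Set.Icc (0 : ℝ) t, Integrable (fun x : ℝ => Real.exp (s * |x|)) μ := by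
  intro s hs
  have key : Integrable (fun x : ℝ => Real.exp (t * |x|)) μ := by
    refine ⟨(by fun_prop : Continuous (fun x : ℝ => Real.exp (t * |x|))).aestronglyMeasurable, ?_⟩
    rw [hasFiniteIntegral_iff_ofReal (Filter.Eventually.of_forall fun x => (Real.exp_pos _).le)]
    have hx : ∀ x : ℝ, ENNReal.ofReal (Real.exp (t * |x|))
        = ∑' n : ℕ, ENNReal.ofReal (t ^ n / n.factorial * |x| ^ n) := fun x => by
      have h1 : HasSum (fun n : ℕ => t ^ n / n.factorial * |x| ^ n) (Real.exp (t * |x|)) := by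
        have := NormedSpace.expSeries_div_hasSum_exp (t * |x|)
        rw [← Real.exp_eq_exp_ℝ] at this
        refine this.congr_fun ?_ |> id
        intro n
        rw [mul_pow]; ring
      rw [← h1.tsum_eq, ENNReal.ofReal_tsum_of_nonneg (fun n => by positivity) h1.summable]
    simp_rw [hx]
    rw [lintegral_tsum (fun n => by fun_prop)]
    have hS := hsum.mul_right (Real.sqrt (μ.real Set.univ))
    refine lt_of_le_of_lt (ENNReal.tsum_le_tsum fun n => ?_) hS.tsum_ofReal_lt_top
    obtain ⟨hi, hb⟩ := moment_bound μ n (hmom n)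
    rw [← ofReal_integral_eq_lintegral_ofReal (hi.const_mul _)
      (Filter.Eventually.of_forall fun x => by positivity), integral_const_mul, mul_assoc]
    gcongr
  refine key.mono' (by fun_prop : Continuous (fun x : ℝ => Real.exp (s * |x|))).aestronglyMeasurable
    (Filter.Eventually.of_forall fun x => ?_)
  rw [Real.norm_eq_abs, Real.abs_exp]
  have := hs.2
  gcongr
end

section
/- Let H be a complex Hilbert space, let A be a bounded positive operator on H (self-adjoint with nonnegative spectrum), let B be a bounded operator on H, and let C ≥ 0 satisfy ‖B A‖ ≤ C and ‖A B‖ ≤ C (operator norms). Then ‖A^{1/2} B A^{1/2}‖ ≤ C, where A^{1/2} denotes the positive square root of A. -/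
/-- Bounded-operator interpolation: if `A` is a bounded positive operator on a complex
Hilbert space, `B` is bounded, and `‖B A‖ ≤ C`, `‖A B‖ ≤ C`, then
`‖A^{1/2} B A^{1/2}‖ ≤ C`, where `A^{1/2}` is the (unique) positive square root of `A`,
here quantified over all positive operators `S` with `S ∘ S = A`. -/
theorem stmt_1 {H : Type*} [NormedAddCommGroup H] [InnerProductSpace ℂ H] [CompleteSpace H]
    (A B : H →L[ℂ] H) (hA : A.IsPositive) (C : ℝ) (hC : 0 ≤ C)
    (h1 : ‖B ∘L A‖ ≤ C) (h2 : ‖A ∘L B‖ ≤ C) :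
    ∀ S : H →L[ℂ] H, S.IsPositive → S ∘L S = A → ‖S ∘L B ∘L S‖ ≤ C := by
  intro S hS hSS
  have hs : star S = S := hS.isSelfAdjoint
  rcases subsingleton_or_nontrivial H with hH | hH
  · have : S ∘L B ∘L S = 0 := Subsingleton.elim _ _
    rw [this]; simpa using hC
  set T : H →L[ℂ] H := S * (B * S) with hT
  change ‖T‖ ≤ C
  set X : H →L[ℂ] H := star B * A * B * S with hX
  have hA' : A = S * S := hSS.symm
  have e1 : star T * T = S * X := by
    simp only [hT, hX, hA', star_mul, hs, mul_assoc]
  have e2 : X * S = star (A * B) * (B * A) := by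
    simp only [hX, hA', star_mul, hs, mul_assoc]
  have hXS : ‖X * S‖ ≤ C * C := by
    rw [e2]
    refine (norm_mul_le _ _).trans ?_
    rw [norm_star]
    exact mul_le_mul h2 h1 (norm_nonneg _) hC
  have key : ‖star T * T‖₊ ≤ Real.toNNReal (C * C) := by
    rw [← ENNReal.coe_le_coe,
      ← (IsSelfAdjoint.star_mul_self T).spectralRadius_eq_nnnorm, e1, spectralRadius]
    refine iSup₂_le fun k hk => ?_
    rw [ENNReal.coe_le_coe, ← NNReal.coe_le_coe, Real.coe_toNNReal _ (mul_nonneg hC hC), coe_nnnorm]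
    change ‖k‖ ≤ C * C
    by_cases hk0 : k = 0
    · subst hk0; simpa using mul_nonneg hC hC
    have : k ∈ spectrum ℂ (X * S) := by
      have h : k ∈ spectrum ℂ (S * X) \ {0} := ⟨hk, hk0⟩
      rw [spectrum.nonzero_mul_comm] at h
      exact h.1
    exact (spectrum.norm_le_norm_of_mem this).trans hXS
  have key' : ‖star T * T‖ ≤ C * C := by
    rw [← NNReal.coe_le_coe, Real.coe_toNNReal _ (mul_nonneg hC hC), coe_nnnorm] at key
    exact key
  rw [CStarRing.norm_star_mul_self] at key'
  exact abs_le_of_sq_le_sq' (by nlinarith) hC |>.2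
end

section
/- Let m, n be nonnegative integers with m + n ≥ 1, and consider Lebesgue measure on (ℝ³)^{m+n}. Let S := {(k_1,…,k_m, k̃_1,…,k̃_n) ∈ (ℝ³)^{m+n} : ∑_{i=1}^m ‖k_i‖ ≤ 1 and ∑_{j=1}^n ‖k̃_j‖ ≤ 1}. Then ∫_S ∏_{i=1}^m ‖k_i‖^{-2} · ∏_{j=1}^n ‖k̃_j‖^{-2} d(k_1,…,k_m,k̃_1,…,k̃_n) ≤ (4π)^{m+n} / (m!·n!). -/
open MeasureTheory

abbrev E3 := EuclideanSpace ℝ (Fin 3)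

lemma radial (f : ℝ → ENNReal) (hf : Measurable f) :
    ∫⁻ x : E3, f ‖x‖ = ENNReal.ofReal (4 * Real.pi) *
      ∫⁻ y in Set.Ioi (0:ℝ), ENNReal.ofReal (y ^ 2) * f y := by
  have hdim : Module.finrank ℝ E3 = 3 := by simp
  calc
    ∫⁻ x : E3, f ‖x‖ = ∫⁻ x : ({(0)}ᶜ : Set E3), f (‖x.1‖) ∂((volume : Measure E3).comap (↑)) := by
      rw [lintegral_subtype_comap (measurableSet_singleton _).compl fun x ↦ f (‖x‖),
        restrict_compl_singleton]
    _ = ∫⁻ x, f x.2 ∂(volume : Measure E3).toSphere.prod (.volumeIoiPow (Module.finrank ℝ E3 - 1)) := by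
      simpa using (volume : Measure E3).measurePreserving_homeomorphUnitSphereProd.lintegral_comp_emb
        (Homeomorph.measurableEmbedding _) (f ∘ Subtype.val ∘ Prod.snd)
    _ = (volume : Measure E3).toSphere Set.univ *
          ∫⁻ x : Set.Ioi (0 : ℝ), f x ∂.volumeIoiPow (Module.finrank ℝ E3 - 1) := by
      have := lintegral_prod_mul (μ := (volume : Measure E3).toSphere)
        (ν := .volumeIoiPow (Module.finrank ℝ E3 - 1)) (f := fun _ => 1)
        (g := fun x : Set.Ioi (0:ℝ) => f x) (by fun_prop) (by fun_prop)
      simpa only [one_mul, lintegral_one] using this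
    _ = _ := by
      rw [hdim, Measure.toSphere_apply_univ, hdim, EuclideanSpace.volume_ball_fin_three]
      congr 1
      · rw [ENNReal.ofReal_one, one_pow, one_mul, ← ENNReal.ofReal_natCast,
          ← ENNReal.ofReal_mul (by positivity)]
        congr 1; push_cast; ring
      · rw [Measure.volumeIoiPow, lintegral_withDensity_eq_lintegral_mul _ (by fun_prop) (by fun_prop)]
        exact lintegral_subtype_comap measurableSet_Ioi fun a ↦ ENNReal.ofReal (a ^ 2) * f a

/-- The integrand, cut off to the simplex of size `r`. -/
noncomputable def FF (n : ℕ) (r : ℝ) (p : Fin n → E3) : ENNReal :=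
  if (∑ i, ‖p i‖) ≤ r then ∏ i, (ENNReal.ofReal (‖p i‖ ^ 2))⁻¹ else 0

noncomputable def BB (n : ℕ) (r : ℝ) : ENNReal :=
  if 0 ≤ r then ENNReal.ofReal ((4 * Real.pi) ^ n / n.factorial * r ^ n) else 0

lemma BB_meas (n : ℕ) : Measurable (BB n) := by
  unfold BB
  exact Measurable.ite measurableSet_Ici (by fun_prop) (by fun_prop)

lemma FF_meas (n : ℕ) (r : ℝ) : Measurable (FF n r) := by
  unfold FF
  refine Measurable.ite (measurableSet_le (by fun_prop) (by fun_prop)) ?_ (by fun_prop)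
  refine Finset.measurable_prod _ fun i _ => ?_
  fun_prop

lemma step (n : ℕ) (r : ℝ) (hr : 0 ≤ r) :
    ENNReal.ofReal (4 * Real.pi) * ∫⁻ y in Set.Ioi (0:ℝ),
      ENNReal.ofReal (y ^ 2) * ((ENNReal.ofReal (y ^ 2))⁻¹ * BB n (r - y)) = BB (n+1) r := by
  have h1 : ∫⁻ y in Set.Ioi (0:ℝ),
      ENNReal.ofReal (y ^ 2) * ((ENNReal.ofReal (y ^ 2))⁻¹ * BB n (r - y)) =
      ∫⁻ y in Set.Ioc 0 r, ENNReal.ofReal ((4 * Real.pi) ^ n / n.factorial * (r - y) ^ n) := by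
    rw [← lintegral_indicator measurableSet_Ioi, ← lintegral_indicator measurableSet_Ioc]
    congr 1; ext y
    by_cases hy : 0 < y
    · have : ENNReal.ofReal (y^2) ≠ 0 := by
        rw [Ne, ENNReal.ofReal_eq_zero]; push Not; positivity
      rw [Set.indicator_of_mem (by exact hy), ← mul_assoc,
        ENNReal.mul_inv_cancel this ENNReal.ofReal_ne_top, one_mul]
      by_cases hyr : y ≤ r
      · rw [Set.indicator_of_mem (by exact ⟨hy, hyr⟩), BB, if_pos (by linarith)]
      · rw [Set.indicator_of_notMem (fun h => hyr h.2), BB, if_neg (by linarith)]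
    · rw [Set.indicator_of_notMem (by exact hy), Set.indicator_of_notMem (fun h => hy h.1)]
  have hc : Continuous fun y : ℝ => (4 * Real.pi) ^ n / n.factorial * (r - y) ^ n := by fun_prop
  rw [h1, ← ofReal_integral_eq_lintegral_ofReal (hc.intervalIntegrable 0 r).1,
    ← intervalIntegral.integral_of_le hr, ← ENNReal.ofReal_mul (by positivity), BB, if_pos hr]
  · congr 1
    rw [intervalIntegral.integral_const_mul,
      intervalIntegral.integral_comp_sub_left (fun y => y ^ n), integral_pow, Nat.factorial_succ]
    push_cast
    have : (n.factorial : ℝ) ≠ 0 := by positivity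
    have : (n : ℝ) + 1 ≠ 0 := by positivity
    rw [sub_self, sub_zero, zero_pow n.succ_ne_zero, sub_zero]
    field_simp
    try ring
  · filter_upwards [ae_restrict_mem measurableSet_Ioc] with y hy
    have : 0 ≤ r - y := by linarith [hy.2]
    simp only [Pi.zero_apply]
    positivity

lemma FF_succ (n : ℕ) (r : ℝ) (k : E3) (q : Fin n → E3) :
    FF (n+1) r (Fin.cons k q) = (ENNReal.ofReal (‖k‖ ^ 2))⁻¹ * FF n (r - ‖k‖) q := by
  simp only [FF, Fin.sum_univ_succ, Fin.prod_univ_succ, Fin.cons_zero, Fin.cons_succ,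
    le_sub_iff_add_le', mul_ite, mul_zero]

lemma main_bound (n : ℕ) : ∀ r : ℝ, ∫⁻ p, FF n r p ≤ BB n r := by
  induction n with
  | zero =>
    intro r
    rw [volume_pi, Measure.pi_of_empty, lintegral_dirac]
    simp [FF, BB]
  | succ n ih =>
    intro r
    by_cases hr : 0 ≤ r
    swap
    · have : ∀ p, FF (n+1) r p = 0 := fun p => if_neg fun h =>
        hr ((Finset.sum_nonneg fun i _ => norm_nonneg _).trans h)
      simp [this]
    have e := (volume_preserving_piFinSuccAbove (fun _ : Fin (n+1) => E3) 0).symm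
    rw [← e.lintegral_comp (FF_meas _ _), Measure.volume_eq_prod]
    refine (lintegral_prod_le _).trans ?_
    rw [← step n r hr, ← radial (fun y => (ENNReal.ofReal (y ^ 2))⁻¹ * BB n (r - y))]
    · refine lintegral_mono fun k => ?_
      have : ∀ q : Fin n → E3, FF (n+1) r ((MeasurableEquiv.piFinSuccAbove
          (fun _ : Fin (n+1) => E3) 0).symm (k, q)) =
          (ENNReal.ofReal (‖k‖ ^ 2))⁻¹ * FF n (r - ‖k‖) q := by
        intro q
        rw [← FF_succ]
        simp [MeasurableEquiv.piFinSuccAbove_symm_apply, Fin.insertNthEquiv]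
      simp only [this]
      rw [lintegral_const_mul _ (FF_meas _ _)]
      gcongr
      exact ih _
    · have := BB_meas n
      fun_prop

/-- The integral estimate (5.7) (scalar content): for `m + n ≥ 1`,
`∫_S ∏ᵢ ‖kᵢ‖⁻² ∏ⱼ ‖k̃ⱼ‖⁻² ≤ (4π)^{m+n} / (m! n!)`, where
`S = {(k, k̃) : ∑ᵢ ‖kᵢ‖ ≤ 1, ∑ⱼ ‖k̃ⱼ‖ ≤ 1} ⊆ (ℝ³)^{m+n}`. -/
theorem stmt_3 (m n : ℕ) (hmn : 1 ≤ m + n) :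
    ∫⁻ p in {p : (Fin m → EuclideanSpace ℝ (Fin 3)) × (Fin n → EuclideanSpace ℝ (Fin 3)) |
        (∑ i, ‖p.1 i‖) ≤ 1 ∧ (∑ j, ‖p.2 j‖) ≤ 1},
      (∏ i, (ENNReal.ofReal (‖p.1 i‖ ^ 2))⁻¹) * ∏ j, (ENNReal.ofReal (‖p.2 j‖ ^ 2))⁻¹
      ≤ ENNReal.ofReal ((4 * Real.pi) ^ (m + n) / (m.factorial * n.factorial)) := by

  have hS : MeasurableSet {p : (Fin m → E3) × (Fin n → E3) |
      (∑ i, ‖p.1 i‖) ≤ 1 ∧ (∑ j, ‖p.2 j‖) ≤ 1} := by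
    rw [Set.setOf_and]
    refine MeasurableSet.inter ?_ ?_
    · exact measurableSet_le (by fun_prop) (by fun_prop)
    · exact measurableSet_le (by fun_prop) (by fun_prop)
  rw [← lintegral_indicator hS]
  calc _ = ∫⁻ p : (Fin m → E3) × (Fin n → E3), FF m 1 p.1 * FF n 1 p.2 := by
        congr 1; ext p
        by_cases h1 : (∑ i, ‖p.1 i‖) ≤ 1 <;> by_cases h2 : (∑ j, ‖p.2 j‖) ≤ 1 <;>
          simp [Set.indicator, FF, h1, h2]
    _ = (∫⁻ p, FF m 1 p) * ∫⁻ p, FF n 1 p := by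
        rw [Measure.volume_eq_prod]
        exact lintegral_prod_mul (FF_meas m 1).aemeasurable (FF_meas n 1).aemeasurable
    _ ≤ BB m 1 * BB n 1 := by gcongr <;> exact main_bound _ _
    _ = _ := by
        rw [BB, BB, if_pos zero_le_one, if_pos zero_le_one, ← ENNReal.ofReal_mul (by positivity)]
        congr 1
        rw [pow_add, one_pow, one_pow, mul_one, mul_one, div_mul_div_comm]
end

section
/- Let 𝓗 be a complex Hilbert space and let χ, χ̄, H, T be bounded linear operators on 𝓗 satisfying: χ and χ̄ commute, χ² + χ̄² = 1, χT = Tχ, and χ̄T = Tχ̄. Set W := H − T and H_χ̄ := T + χ̄Wχ̄. Assume there exist bounded operators S and G on 𝓗 such that for every v in the range of χ̄: S v and G v lie in the range of χ̄, T(Sv) = v, S(Tv) = v, H_χ̄(Gv) = v, and G(H_χ̄ v) = v. Define the Feshbach operator F := T + χWχ − χWχ̄ G χ̄Wχ and the auxiliary operator Q := χ − χ̄ G χ̄ W χ. Then: (i) for every ψ ∈ ker H one has χψ ∈ ker F; (ii) for every φ ∈ ker F one has Qφ ∈ ker H; (iii) the restricted maps χ : ker H → ker F and Q : ker F → ker H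 are mutually inverse linear isomorphisms (Q(χψ) = ψ for ψ ∈ ker H and χ(Qφ) = φ for φ ∈ ker F). -/
/-- Isospectrality of the smooth Feshbach map (Theorem F.1, bounded case):
given a Feshbach pair `(H, T)` for `χ` (with `χ² + χ̄² = 1`, `χ`, `χ̄` commuting with
each other and with `T`, and bounded operators `S`, `G` realizing the inverses of
`T` and of `H_χ̄ = T + χ̄Wχ̄` on `Ran χ̄`), the Feshbach operator
`F = T + χWχ − χWχ̄ G χ̄Wχ` and the auxiliary operator `Q = χ − χ̄ G χ̄Wχ` satisfy:
`χ` maps `ker H` into `ker F`, `Q` maps `ker F` into `ker H`, and these restricted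
maps are mutually inverse linear isomorphisms. -/
theorem stmt_7 {𝓗 : Type*} [NormedAddCommGroup 𝓗] [InnerProductSpace ℂ 𝓗] [CompleteSpace 𝓗]
    (χ χb H T : 𝓗 →L[ℂ] 𝓗)
    (hcomm : χ ∘L χb = χb ∘L χ)
    (hpart : χ ∘L χ + χb ∘L χb = 1)
    (hχT : χ ∘L T = T ∘L χ)
    (hχbT : χb ∘L T = T ∘L χb)
    (W : 𝓗 →L[ℂ] 𝓗) (hW : W = H - T)
    (Hχb : 𝓗 →L[ℂ] 𝓗) (hHχb : Hχb = T + χb ∘L W ∘L χb)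
    (S G : 𝓗 →L[ℂ] 𝓗)
    (hS : ∀ v ∈ Set.range χb, S v ∈ Set.range χb ∧ T (S v) = v ∧ S (T v) = v)
    (hG : ∀ v ∈ Set.range χb, G v ∈ Set.range χb ∧ Hχb (G v) = v ∧ G (Hχb v) = v)
    (F : 𝓗 →L[ℂ] 𝓗)
    (hF : F = T + χ ∘L W ∘L χ - χ ∘L W ∘L χb ∘L G ∘L χb ∘L W ∘L χ)
    (Q : 𝓗 →L[ℂ] 𝓗)
    (hQ : Q = χ - χb ∘L G ∘L χb ∘L W ∘L χ) :
    (∀ ψ, H ψ = 0 → F (χ ψ) = 0) ∧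
    (∀ φ, F φ = 0 → H (Q φ) = 0) ∧
    (∀ ψ, H ψ = 0 → Q (χ ψ) = ψ) ∧
    (∀ φ, F φ = 0 → χ (Q φ) = φ) := by
  have c1 : ∀ x, χ (χb x) = χb (χ x) := fun x => DFunLike.congr_fun hcomm x
  have c2 : ∀ x, χ (χ x) + χb (χb x) = x := fun x => DFunLike.congr_fun hpart x
  have c3 : ∀ x, χ (T x) = T (χ x) := fun x => DFunLike.congr_fun hχT x
  have c4 : ∀ x, χb (T x) = T (χb x) := fun x => DFunLike.congr_fun hχbT x
  have hWx : ∀ x, H x = T x + W x := fun x => by simp [hW]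
  have hHx : ∀ x, Hχb x = T x + χb (W (χb x)) := fun x => by simp [hHχb]
  have hQx : ∀ x, Q x = χ x - χb (G (χb (W (χ x)))) := fun x => by simp [hQ]
  have hFx : ∀ x, F x = T x + χ (W (Q x)) := fun x => by
    rw [hQx]
    simp only [hF, ContinuousLinearMap.sub_apply, ContinuousLinearMap.add_apply,
      ContinuousLinearMap.comp_apply, map_sub]
    abel
  have key3 : ∀ ψ, H ψ = 0 → Q (χ ψ) = ψ := by
    intro ψ h
    have hw : W ψ = - T ψ := by
      rw [hWx] at h
      exact eq_neg_of_add_eq_zero_right h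
    have e1 : χ (χ ψ) = ψ - χb (χb ψ) := eq_sub_of_add_eq (c2 ψ)
    have e2 : χb (W (χ (χ ψ))) = - Hχb (χb ψ) := by
      rw [e1, map_sub, hw, map_sub, map_neg, c4, hHx]
      abel
    rw [hQx, e2, map_neg, (hG _ ⟨ψ, rfl⟩).2.2, map_neg, sub_neg_eq_add, c2]
  -- the two identities behind the reconstruction from `ker F`
  have hTg : ∀ φ, T (G (χb (W (χ φ)))) = χb (W (Q φ)) := by
    intro φ
    have h := (hG (χb (W (χ φ))) ⟨_, rfl⟩).2.1
    rw [hHx] at h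
    rw [hQx, map_sub, map_sub]
    exact eq_sub_of_add_eq h
  have hTφ : ∀ φ, F φ = 0 → T φ = - χ (W (Q φ)) := by
    intro φ h
    rw [hFx] at h
    exact eq_neg_of_add_eq_zero_left h
  refine ⟨?_, ?_, key3, ?_⟩
  · intro ψ h
    rw [hFx, key3 ψ h, ← c3, ← map_add, ← hWx, h, map_zero]
  · intro φ h
    have e : T (Q φ) = - W (Q φ) := by
      have e0 : T (Q φ) = χ (T φ) - χb (T (G (χb (W (χ φ))))) := by
        rw [hQx, map_sub, c3, c4]
      rw [e0, hTg, hTφ φ h, map_neg]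
      conv_rhs => rw [← c2 (W (Q φ))]
      abel
    rw [hWx, e, neg_add_cancel]
  · intro φ h
    obtain ⟨k, hk⟩ := (hG (χb (W (χ φ))) ⟨_, rfl⟩).1
    have hu : χb φ + χ (G (χb (W (χ φ)))) = 0 := by
      have hT0 : T (χb φ + χ (G (χb (W (χ φ))))) = 0 := by
        rw [map_add, ← c4, ← c3, hTg, hTφ φ h, map_neg, c1, neg_add_cancel]
      have hr : χb φ + χ (G (χb (W (χ φ)))) ∈ Set.range χb :=
        ⟨φ + χ k, by rw [map_add, ← c1, hk]⟩
      have := (hS _ hr).2.2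
      rw [hT0, map_zero] at this
      exact this.symm
    have e1 : χ (χ φ) = φ - χb (χb φ) := eq_sub_of_add_eq (c2 φ)
    rw [hQx, map_sub, c1, e1, sub_sub, ← map_add, hu, map_zero, sub_zero]
end

section
/- Let 𝓗 be a complex Hilbert space and let χ, χ̄, T, W be bounded linear operators on 𝓗 satisfying: χ and χ̄ commute, χ² + χ̄² = 1, χT = Tχ, and χ̄T = Tχ̄. Assume there is a bounded operator S on 𝓗 such that for every v in the range of χ̄: S v lies in the range of χ̄, T(Sv) = v and S(Tv) = v; and assume the smallness conditions ‖S χ̄ W χ̄‖ < 1 and ‖χ̄ W S χ̄‖ < 1 (operator norms). Then H_χ̄ := T + χ̄Wχ̄ is bounded invertible in the range of χ̄: there exists a bounded operator G on 𝓗 such that for every v in the range of χ̄, G v lies in the range of χ̄, H_χ̄(Gv) = v, and G(H_χ̄ v) = v. -/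
/-- Neumann-series criterion for Feshbach pairs (Lemma F.3, bounded case):
if `χ`, `χ̄` commute, `χ² + χ̄² = 1`, `T` commutes with `χ` and `χ̄`, `T` is bounded
invertible on `Ran χ̄` (with inverse realized by the bounded operator `S` preserving
`Ran χ̄`), and `‖S χ̄ W χ̄‖ < 1`, `‖χ̄ W S χ̄‖ < 1`, then `H_χ̄ = T + χ̄Wχ̄` is bounded
invertible on `Ran χ̄`. -/
theorem stmt_8 {𝓗 : Type*} [NormedAddCommGroup 𝓗] [InnerProductSpace ℂ 𝓗] [CompleteSpace 𝓗]
    (χ χb T W : 𝓗 →L[ℂ] 𝓗)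
    (hcomm : χ ∘L χb = χb ∘L χ)
    (hpart : χ ∘L χ + χb ∘L χb = 1)
    (hχT : χ ∘L T = T ∘L χ)
    (hχbT : χb ∘L T = T ∘L χb)
    (S : 𝓗 →L[ℂ] 𝓗)
    (hS : ∀ v ∈ Set.range χb, S v ∈ Set.range χb ∧ T (S v) = v ∧ S (T v) = v)
    (h1 : ‖S ∘L χb ∘L W ∘L χb‖ < 1)
    (h2 : ‖χb ∘L W ∘L S ∘L χb‖ < 1) :
    ∃ G : 𝓗 →L[ℂ] 𝓗, ∀ v ∈ Set.range χb,
      G v ∈ Set.range χb ∧ (T + χb ∘L W ∘L χb) (G v) = v ∧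
        G ((T + χb ∘L W ∘L χb) v) = v := by
  set A : 𝓗 →L[ℂ] 𝓗 := S ∘L χb ∘L W ∘L χb with hA
  have hu : IsUnit (1 + A) := by
    have h := isUnit_one_sub_of_norm_lt_one (x := -A) (by rwa [norm_neg])
    rwa [sub_neg_eq_add] at h
  obtain ⟨u, hu⟩ := hu
  let B : 𝓗 →L[ℂ] 𝓗 := ((u⁻¹ : (𝓗 →L[ℂ] 𝓗)ˣ) : 𝓗 →L[ℂ] 𝓗)
  have hl : ∀ x, B (x + A x) = x := by
    intro x
    have h : B * (1 + A) = 1 := by rw [← hu]; exact u.inv_mul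
    exact DFunLike.congr_fun h x
  have hr : ∀ x, B x + A (B x) = x := by
    intro x
    have h : (1 + A) * B = 1 := by rw [← hu]; exact u.mul_inv
    exact DFunLike.congr_fun h x
  have hAx : ∀ x, A x = S (χb (W (χb x))) := fun x => rfl
  refine ⟨B ∘L S, fun v hv => ⟨?_, ?_, ?_⟩⟩
  · obtain ⟨a, ha⟩ := (hS v hv).1
    obtain ⟨b, hb⟩ := (hS (χb (W (χb (B (S v))))) ⟨_, rfl⟩).1
    refine ⟨a - b, ?_⟩
    rw [map_sub, ha, hb, ← hAx]
    exact sub_eq_of_eq_add (hr (S v)).symm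
  · have h := congrArg T (hr (S v))
    rw [map_add, (hS v hv).2.1, hAx, (hS _ ⟨_, rfl⟩).2.1] at h
    exact h
  · change B (S (T v + χb (W (χb v)))) = v
    rw [map_add, (hS v hv).2.2, ← hAx, hl]
end
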